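/- arXiv:1505.05037 — 2 statements merged into one kernel-verified Lean document; each statement's English description precedes it below -/
import Mathlib

section
/- There exists ρ₀ > 0 (depending only on d, m, a₁,…,a_d, α, p₁, M and c₁, c₂) with the following property. Let ρ ≥ ρ₀, let δ ∈ Γ/2 be minimal in its direction (i.e. (Γ/2) ∩ ℝδ = ℤδ), and let γ ∈ ℝ^d satisfy c₁ρ ≤ |γ| ≤ c₂ρ, γ ∈ V_δ(ρ^{α₁}), and γ ∉ V_a(ρ^{α₂}) for every a ∈ Γ(p₁ρ^α) with a ∉ ℝδ. Let h₁,…,h_{b₁} be an enumeration of B₁(γ,p₁) such that h₁,…,h_{a₁} are exactly the elements of B₁(γ,p₁) ∩ {γ + nδ : n ∈ ℤ}, and let C = C(γ,δ) be the associated block matrix. Then: (a) if η is an eigenvalue of C with |η − |h_s|²| < M for some s ∈ {1,…,a₁}, then |η − |h_τ|²| > ρ^{α₂}/4 for every τ ∈ {a₁+1,…,b₁}; (b) if η is an eigenvalue of C with |η − |h_s|²| < M for some s ∈ {a₁+1,…,b₁}, then |η − |h_τ|²| > ρ^{α₂}/4 for every τ ∈ {1,…,a₁}. -/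
open Matrix

noncomputable section

/-- The lattice `Γ/2 = {(n₁π/(2a₁),…,n_dπ/(2a_d)) : n ∈ ℤ^d}`. -/
def halfLattice {d : ℕ} (a : Fin d → ℝ) : Set (EuclideanSpace ℝ (Fin d)) :=
  {x | ∃ n : Fin d → ℤ, ∀ i, x i = (n i : ℝ) * Real.pi / (2 * a i)}

/-- `Γ(r) = {b ∈ Γ/2 : 0 < |b| < r}`. -/
def latticeBall {d : ℕ} (a : Fin d → ℝ) (r : ℝ) : Set (EuclideanSpace ℝ (Fin d)) :=
  {b | b ∈ halfLattice a ∧ 0 < ‖b‖ ∧ ‖b‖ < r}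

/-- The resonance domain `V_b(M) = {x : | ‖x‖² − ‖x+b‖² | < M}`. -/
def resDomain {d : ℕ} (b : EuclideanSpace ℝ (Fin d)) (M : ℝ) : Set (EuclideanSpace ℝ (Fin d)) :=
  {x | |‖x‖ ^ 2 - ‖x + b‖ ^ 2| < M}

/-- `B₁(γ,p₁) = {γ + nδ + a : n ∈ ℤ, |nδ| < (1/2)ρ^{α₂/2}, a ∈ Γ(p₁ρ^α) ∪ {0}}` (α₂ = 9α). -/
def B1Set {d : ℕ} (a : Fin d → ℝ) (δ γ : EuclideanSpace ℝ (Fin d)) (ρ α : ℝ) (p₁ : ℕ) :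
    Set (EuclideanSpace ℝ (Fin d)) :=
  {x | ∃ n : ℤ, ‖(n : ℝ) • δ‖ < (1 / 2) * ρ ^ (9 * α / 2) ∧
    ∃ w ∈ latticeBall a ((p₁ : ℝ) * ρ ^ α) ∪ {0}, x = γ + (n : ℝ) • δ + w}

/-- The `m·b₁ × m·b₁` block matrix `C(γ,δ)` with diagonal blocks `|h_τ|² I_m` and off-diagonal
blocks `V_{h_τ − h_ξ}`. -/
def blockC {d m b₁ : ℕ} (V : EuclideanSpace ℝ (Fin d) → Matrix (Fin m) (Fin m) ℝ)
    (h : Fin b₁ → EuclideanSpace ℝ (Fin d)) :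
    Matrix (Fin b₁ × Fin m) (Fin b₁ × Fin m) ℝ :=
  fun p q =>
    if p.1 = q.1 then (if p.2 = q.2 then ‖h p.1‖ ^ 2 else 0)
    else V (h p.1 - h q.1) p.2 q.2

/-- `η` is an eigenvalue of the square real matrix `A`. -/
def Matrix.IsEigenvalueOf {n : Type*} [Fintype n] [DecidableEq n]
    (A : Matrix n n ℝ) (η : ℝ) : Prop :=
  ∃ x : n → ℝ, x ≠ 0 ∧ A.mulVec x = η • x

/-- Expansion of `‖γ + nδ‖²` in terms of the resonance defect `‖γ + δ‖² - ‖γ‖²`. -/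
theorem norm_add_intCast_smul_sq {E : Type*} [NormedAddCommGroup E] [InnerProductSpace ℝ E]
    (γ δ : E) (n : ℤ) :
    ‖γ + (n : ℝ) • δ‖ ^ 2 =
      ‖γ‖ ^ 2 + n * (‖γ + δ‖ ^ 2 - ‖γ‖ ^ 2) + ((n : ℝ) ^ 2 - n) * ‖δ‖ ^ 2 := by
  rw [norm_add_sq_real, norm_add_sq_real, inner_smul_right, norm_smul, mul_pow,
    Real.norm_eq_abs, sq_abs]
  ring

/-- If `‖nδ‖ ≤ B` then the quadratic part `(n² - n)‖δ‖²` lies in `[0, 2B²]`. -/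
theorem intCast_sq_sub_mul_mem_Icc {n : ℤ} {r B : ℝ} (hr : 0 ≤ r) (h : |(n : ℝ)| * r ≤ B) :
    ((n : ℝ) ^ 2 - n) * r ^ 2 ∈ Set.Icc 0 (2 * B ^ 2) := by
  have h1 : (0 : ℝ) ≤ (n : ℝ) ^ 2 - n := by
    have : (n : ℤ) ≤ n ^ 2 := Int.le_self_sq n
    have : (n : ℝ) ≤ (n : ℝ) ^ 2 := by exact_mod_cast this
    linarith
  have h2 : (n : ℝ) ^ 2 - n ≤ 2 * (n : ℝ) ^ 2 := by
    have : (-n : ℤ) ≤ (-n) ^ 2 := Int.le_self_sq (-n)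
    have : (-n : ℝ) ≤ (-n : ℝ) ^ 2 := by exact_mod_cast this
    nlinarith
  have h3 : (|(n : ℝ)| * r) ^ 2 ≤ B ^ 2 := pow_le_pow_left₀ (by positivity) h 2
  rw [mul_pow, sq_abs] at h3
  refine ⟨by positivity, ?_⟩
  nlinarith [mul_le_mul_of_nonneg_right h2 (sq_nonneg r)]

/-- Nonzero points of `Γ/2` are bounded away from the origin. -/
theorem le_norm_of_mem_halfLattice {d : ℕ} {a : Fin d → ℝ} (ha : ∀ i, 0 < a i)
    {δ : EuclideanSpace ℝ (Fin d)} (hδ : δ ∈ halfLattice a) (h0 : δ ≠ 0) :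
    Real.pi / (2 * ∑ i, a i) ≤ ‖δ‖ := by
  obtain ⟨n, hn⟩ := hδ
  obtain ⟨i, hi⟩ : ∃ i, n i ≠ 0 := by
    by_contra! hall
    exact h0 (by ext i; simp [hn i, hall i])
  have hai := ha i
  have hle : a i ≤ ∑ j, a j :=
    Finset.single_le_sum (fun j _ => (ha j).le) (Finset.mem_univ i)
  have h1 : (1 : ℝ) ≤ |(n i : ℝ)| := by exact_mod_cast Int.one_le_abs hi
  calc Real.pi / (2 * ∑ j, a j) ≤ Real.pi / (2 * a i) := by gcongr
    _ ≤ |(n i : ℝ)| * (Real.pi / (2 * a i)) := le_mul_of_one_le_left (by positivity) h1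
    _ = ‖δ i‖ := by
      rw [hn i, Real.norm_eq_abs, mul_div_assoc, abs_mul,
        abs_of_pos (show 0 < Real.pi / (2 * a i) by positivity)]
    _ ≤ ‖δ‖ := PiLp.norm_apply_le δ i

/-- Separation of `‖γ + nδ‖²` from `‖γ + kδ + w‖²` when `γ` is resonant in the direction `δ` and
non-resonant in the direction `w`. -/
theorem sq_norm_separation {E : Type*} [NormedAddCommGroup E] [InnerProductSpace ℝ E]
    {γ δ w : E} {n k : ℤ} {X Y P c M : ℝ} (hP : 0 ≤ P) (hc : 0 < c) (hM : 0 ≤ M)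
    (hY : 1 ≤ Y) (hYX : Y ^ 4 ≤ X)
    (hlarge : 4 * (3 * P + 2 * P ^ 2 + 1 / c + 2 * P / c + M) < Y)
    (hδ : c ≤ ‖δ‖) (hn : ‖(n : ℝ) • δ‖ ≤ X / 2 + P * Y) (hk : ‖(k : ℝ) • δ‖ ≤ X / 2)
    (hw : ‖w‖ ≤ P * Y) (hres : |‖γ‖ ^ 2 - ‖γ + δ‖ ^ 2| ≤ Y ^ 3)
    (hnonres : X ^ 2 ≤ |‖γ‖ ^ 2 - ‖γ + w‖ ^ 2|) :
    X ^ 2 / 4 + M < |‖γ + (n : ℝ) • δ‖ ^ 2 - ‖γ + (k : ℝ) • δ + w‖ ^ 2| := by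
  have hX1 : 1 ≤ X := (one_le_pow₀ hY).trans hYX
  have hX0 : 0 < X := by linarith
  have hY0 : 0 < Y := by linarith
  set B := X / 2 + P * Y with hB
  have hPY : 0 ≤ P * Y := by positivity
  have hkB : ‖(k : ℝ) • δ‖ ≤ B := by linarith
  set e := ‖γ + δ‖ ^ 2 - ‖γ‖ ^ 2 with he
  have hee : |e| ≤ Y ^ 3 := by rwa [he, abs_sub_comm]
  have hlin : ∀ j : ℤ, ‖(j : ℝ) • δ‖ ≤ B → |(j : ℝ) * e| ≤ B / c * Y ^ 3 := by
    intro j hj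
    rw [norm_smul, Real.norm_eq_abs] at hj
    have : |(j : ℝ)| ≤ B / c := by
      rw [le_div_iff₀ hc]
      exact (mul_le_mul_of_nonneg_left hδ (abs_nonneg _)).trans hj
    rw [abs_mul]
    gcongr
  have hquad : ∀ j : ℤ, ‖(j : ℝ) • δ‖ ≤ B →
      ((j : ℝ) ^ 2 - j) * ‖δ‖ ^ 2 ∈ Set.Icc 0 (2 * B ^ 2) := by
    intro j hj
    rw [norm_smul, Real.norm_eq_abs] at hj
    exact intCast_sq_sub_mul_mem_Icc (norm_nonneg _) hj
  have hinner : |inner ℝ ((k : ℝ) • δ) w| ≤ X / 2 * (P * Y) :=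
    (abs_real_inner_le_norm _ _).trans (mul_le_mul hk hw (norm_nonneg _) (by positivity))
  have hexp : ‖γ + (k : ℝ) • δ + w‖ ^ 2 =
      ‖γ + w‖ ^ 2 - ‖γ‖ ^ 2 + ‖γ + (k : ℝ) • δ‖ ^ 2 + 2 * inner ℝ ((k : ℝ) • δ) w := by
    rw [norm_add_sq_real (γ + (k : ℝ) • δ) w, norm_add_sq_real γ w, inner_add_left]
    ring
  have hbound : 2 * B ^ 2 + 2 * (B / c * Y ^ 3) + X * (P * Y) + M < 3 / 4 * X ^ 2 := by
    have hXY : 1 ≤ Y ^ 3 := one_le_pow₀ hY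
    have hYY : Y ≤ Y ^ 3 := le_self_pow₀ hY (by norm_num)
    have e1 : X * Y ≤ X * Y ^ 3 := by gcongr
    have e2 : Y ^ 2 ≤ X * Y ^ 3 := by
      calc Y ^ 2 ≤ Y ^ 3 := pow_le_pow_right₀ hY (by norm_num)
        _ ≤ X * Y ^ 3 := le_mul_of_one_le_left (by positivity) hX1
    have e3 : Y ^ 4 ≤ X * Y ^ 3 := hYX.trans (le_mul_of_one_le_right hX0.le hXY)
    have e4 : 1 ≤ X * Y ^ 3 := one_le_mul_of_one_le_of_one_le hX1 hXY
    have hci : 0 ≤ 1 / c := by positivity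
    have f1 := mul_le_mul_of_nonneg_left e1 hP
    have f2 := mul_le_mul_of_nonneg_left e2 (sq_nonneg P)
    have f3 := mul_le_mul_of_nonneg_left e3 (mul_nonneg hP hci)
    have f4 := mul_le_mul_of_nonneg_left e4 hM
    have g1 : 4 * (3 * P + 2 * P ^ 2 + 1 / c + 2 * P / c + M) * (X * Y ^ 3) < Y * (X * Y ^ 3) :=
      mul_lt_mul_of_pos_right hlarge (by positivity)
    have g2 : Y * (X * Y ^ 3) ≤ X ^ 2 := by
      calc Y * (X * Y ^ 3) = X * Y ^ 4 := by ring
        _ ≤ X * X := by gcongr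
        _ = X ^ 2 := by ring
    have hBc : B / c * Y ^ 3 = 1 / c * (X * Y ^ 3) / 2 + P * (1 / c) * Y ^ 4 := by
      rw [hB]; ring
    have hPc : 2 * P / c = 2 * (P * (1 / c)) := by ring
    rw [hBc, hB]
    rw [hPc] at g1
    linarith
  have hn1 := abs_le.mp (hlin n hn)
  have hk1 := abs_le.mp (hlin k hkB)
  have hn2 := hquad n hn
  have hk2 := hquad k hkB
  have hi := abs_le.mp hinner
  rw [hexp, norm_add_intCast_smul_sq γ δ n, norm_add_intCast_smul_sq γ δ k, ← he, lt_abs]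
  rcases le_abs.mp hnonres with h | h
  · left; linarith [hn2.1, hk2.2]
  · right; linarith [hn2.2, hk2.1]

/-- STATEMENT 3 (Lemma 2.1 of the paper), with `α₁ = 3α`, `α₂ = 9α`. -/
theorem stmt3 (d : ℕ) (hd : 2 ≤ d) (m : ℕ) (hm : 2 ≤ m)
    (a : Fin d → ℝ) (ha : ∀ i, 0 < a i)
    (α : ℝ) (hα0 : 0 < α) (hα1 : α < 1 / ((d : ℝ) + 20))
    (p₁ : ℕ) (hp₁ : 0 < p₁) (M : ℝ) (hM : 0 < M)
    (c₁ c₂ : ℝ) (hc₁ : 0 < c₁) (hc₂ : 0 < c₂) :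
    ∃ ρ₀ > (0 : ℝ), ∀ ρ : ℝ, ρ₀ ≤ ρ →
      -- the family of matrix Fourier coefficients
      ∀ V : EuclideanSpace ℝ (Fin d) → Matrix (Fin m) (Fin m) ℝ,
        (∀ b ∈ halfLattice a, (V b).IsSymm) →
        (∀ b ∈ halfLattice a, V (-b) = (V b)ᵀ) →
        Summable (fun b : halfLattice a => ‖Matrix.toEuclideanCLM (𝕜 := ℝ) (V b)‖) →
        (∑' b : halfLattice a, ‖Matrix.toEuclideanCLM (𝕜 := ℝ) (V b)‖) ≤ M →
      -- δ ∈ Γ/2, minimal in its direction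
      ∀ δ : EuclideanSpace ℝ (Fin d), δ ∈ halfLattice a → δ ≠ 0 →
        (∀ x ∈ halfLattice a, (∃ t : ℝ, x = t • δ) → ∃ n : ℤ, x = (n : ℝ) • δ) →
      ∀ γ : EuclideanSpace ℝ (Fin d),
        c₁ * ρ ≤ ‖γ‖ → ‖γ‖ ≤ c₂ * ρ →
        γ ∈ resDomain δ (ρ ^ (3 * α)) →
        (∀ w ∈ latticeBall a ((p₁ : ℝ) * ρ ^ α), (¬∃ t : ℝ, w = t • δ) →
          γ ∉ resDomain w (ρ ^ (9 * α))) →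
      -- enumeration h₁,…,h_{b₁} of B₁(γ,p₁), with h₁,…,h_{a₁} those of the form γ + nδ
      ∀ b₁ a₁ : ℕ, a₁ ≤ b₁ →
      ∀ h : Fin b₁ → EuclideanSpace ℝ (Fin d), Function.Injective h →
        Set.range h = B1Set a δ γ ρ α p₁ →
        (∀ τ : Fin b₁, ((τ : ℕ) < a₁ ↔ ∃ n : ℤ, h τ = γ + (n : ℝ) • δ)) →
      ∀ η : ℝ, (blockC V h).IsEigenvalueOf η →
        -- (a)
        ((∃ s : Fin b₁, (s : ℕ) < a₁ ∧ |η - ‖h s‖ ^ 2| < M) →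
          ∀ τ : Fin b₁, a₁ ≤ (τ : ℕ) → ρ ^ (9 * α) / 4 < |η - ‖h τ‖ ^ 2|) ∧
        -- (b)
        ((∃ s : Fin b₁, a₁ ≤ (s : ℕ) ∧ |η - ‖h s‖ ^ 2| < M) →
          ∀ τ : Fin b₁, (τ : ℕ) < a₁ → ρ ^ (9 * α) / 4 < |η - ‖h τ‖ ^ 2|) := by
  have hS : 0 < ∑ i, a i :=
    Finset.sum_pos (fun i _ => ha i) ⟨⟨0, by omega⟩, Finset.mem_univ _⟩
  set c : ℝ := Real.pi / (2 * ∑ i, a i) with hc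
  have hc0 : 0 < c := by positivity
  set P : ℝ := (p₁ : ℝ)
  have hP : 0 ≤ P := Nat.cast_nonneg _
  set K : ℝ := 4 * (3 * P + 2 * P ^ 2 + 1 / c + 2 * P / c + M) + 1 with hK
  have hK1 : 1 ≤ K := by
    have : 0 ≤ 4 * (3 * P + 2 * P ^ 2 + 1 / c + 2 * P / c + M) := by positivity
    linarith
  have hK0 : 0 < K := by linarith
  refine ⟨K ^ (1 / α), Real.rpow_pos_of_pos hK0 _, ?_⟩
  intro ρ hρ V _ _ _ _ δ hδ hδ0 hmin γ _ _ hres hnonres b₁ a₁ _ h _ hrange hline η _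
  have hρ1 : 1 ≤ ρ := (Real.one_le_rpow hK1 (by positivity)).trans hρ
  have hρ0 : 0 < ρ := by linarith
  set Y : ℝ := ρ ^ α with hYdef
  set X : ℝ := ρ ^ (9 * α / 2) with hXdef
  have hX2 : ρ ^ (9 * α) = X ^ 2 := by
    rw [hXdef, ← Real.rpow_mul_natCast hρ0.le]; congr 1; push_cast; ring
  have hY3 : ρ ^ (3 * α) = Y ^ 3 := by
    rw [hYdef, ← Real.rpow_mul_natCast hρ0.le]; congr 1; push_cast; ring
  have hYX : Y ^ 4 ≤ X := by
    rw [hYdef, hXdef, ← Real.rpow_mul_natCast hρ0.le]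
    exact Real.rpow_le_rpow_of_exponent_le hρ1 (by push_cast; linarith)
  have hKY : K ≤ Y := by
    have := Real.rpow_le_rpow (by positivity) hρ hα0.le
    rwa [← Real.rpow_mul hK0.le, one_div_mul_cancel hα0.ne', Real.rpow_one] at this
  have hX0 : 0 < X := Real.rpow_pos_of_pos hρ0 _
  have hY0 : 0 < Y := Real.rpow_pos_of_pos hρ0 _
  have hmem : ∀ τ, h τ ∈ B1Set a δ γ ρ α p₁ := fun τ => hrange ▸ Set.mem_range_self τ
  have hsep : ∀ s τ : Fin b₁, (s : ℕ) < a₁ → a₁ ≤ (τ : ℕ) →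
      X ^ 2 / 4 + M < |‖h s‖ ^ 2 - ‖h τ‖ ^ 2| := by
    intro s τ hs hτ
    obtain ⟨n, hn⟩ := (hline s).mp hs
    have hnB : ‖(n : ℝ) • δ‖ ≤ X / 2 + P * Y := by
      obtain ⟨j, hj, w, hw, hsw⟩ := hmem s
      have hwn : ‖w‖ ≤ P * Y := by
        rcases hw with hw | hw
        · exact hw.2.2.le
        · rw [Set.mem_singleton_iff.mp hw, norm_zero]; positivity
      have heq : (n : ℝ) • δ = (j : ℝ) • δ + w := by
        rw [hn, add_assoc] at hsw
        exact add_left_cancel hsw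
      rw [heq]
      refine (norm_add_le _ _).trans ?_
      linarith
    obtain ⟨k, hk, w, hw, hτw⟩ := hmem τ
    have hnot : ¬∃ j : ℤ, h τ = γ + (j : ℝ) • δ := fun hj =>
      absurd ((hline τ).mpr hj) (not_lt.mpr hτ)
    rcases hw with hw | hw
    · have hpar : ¬∃ t : ℝ, w = t • δ := by
        intro ht
        obtain ⟨j, hj⟩ := hmin w hw.1 ht
        refine hnot ⟨k + j, ?_⟩
        rw [hτw, hj]
        push_cast
        rw [add_smul, add_assoc]
      have hnr := hnonres w hw hpar
      simp only [resDomain, Set.mem_ofPred_eq, not_lt, hX2] at hnr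
      simp only [resDomain, Set.mem_ofPred_eq, hY3] at hres
      rw [hn, hτw]
      exact sq_norm_separation hP hc0 hM.le (hK1.trans hKY) hYX (by linarith)
        (le_norm_of_mem_halfLattice ha hδ hδ0) hnB (by linarith) hw.2.2.le hres.le hnr
    · refine absurd ⟨k, ?_⟩ hnot
      rw [hτw, Set.mem_singleton_iff.mp hw, add_zero]
  rw [hX2]
  constructor
  · rintro ⟨s, hs, hηs⟩ τ hτ
    have h1 := hsep s τ hs hτ
    have h2 := abs_sub_le (‖h s‖ ^ 2) η (‖h τ‖ ^ 2)
    rw [abs_sub_comm (‖h s‖ ^ 2) η] at h2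
    linarith
  · rintro ⟨s, hs, hηs⟩ τ hτ
    have h1 := hsep τ s hτ hs
    have h2 := abs_sub_le (‖h τ‖ ^ 2) η (‖h s‖ ^ 2)
    rw [abs_sub_comm (‖h τ‖ ^ 2) η] at h2
    linarith
end
end

section
/- There exist c > 0 and ρ₀ > 0 (depending only on d, m, a₁,…,a_d, α, p₁, M and c₁, c₂) with the following property. Let ρ ≥ ρ₀, let δ ∈ Γ/2 be minimal in its direction (i.e. (Γ/2) ∩ ℝδ = ℤδ), and let γ ∈ ℝ^d satisfy c₁ρ ≤ |γ| ≤ c₂ρ, γ ∈ V_δ(ρ^{α₁}), and γ ∉ V_a(ρ^{α₂}) for every a ∈ Γ(p₁ρ^α) with a ∉ ℝδ. Let h₁,…,h_{b₁} be an enumeration of B₁(γ,p₁) such that h₁,…,h_{a₁} are exactly the elements of B₁(γ,p₁) ∩ {γ + nδ : n ∈ ℤ}, let C = C(γ,δ) be the associated block matrix and D = D(γ,δ) its leading principal m·a₁ × m·a₁ submatrix. Then for every eigenvalue η̃ of D there exists an eigenvalue η of C such that |η − η̃| ≤ c·ρ^{−(1/2)α₂}. -/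
open Matrix

noncomputable section

/-- A symmetric matrix has an eigenvalue within `ε` of `η` as soon as some nonzero vector is an
`ε`-approximate eigenvector for `η`. -/
theorem Matrix.exists_isEigenvalueOf_of_approx {ι : Type*} [Fintype ι] [DecidableEq ι]
    {A : Matrix ι ι ℝ} (hA : A.IsSymm) {η ε : ℝ} (hε : 0 ≤ ε) {y : ι → ℝ} (hy : y ≠ 0)
    (h : ∑ i, ((A *ᵥ y) i - η * y i) ^ 2 ≤ ε ^ 2 * ∑ i, y i ^ 2) :
    ∃ η', A.IsEigenvalueOf η' ∧ |η' - η| ≤ ε := by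
  have hH : A.IsHermitian := (Matrix.conjTranspose_eq_transpose_of_trivial A).trans hA
  set b := hH.eigenvectorBasis with hb
  by_contra! hcon
  have hfar : ∀ j, ε < |hH.eigenvalues j - η| := fun j =>
    hcon _ ⟨b j, fun h0 => b.orthonormal.ne_zero j (by ext i; exact congrFun h0 i),
      hH.mulVec_eigenvectorBasis j⟩
  have hcoord : ∀ j, inner ℝ (b j) (WithLp.toLp 2 (A *ᵥ y - η • y))
      = (hH.eigenvalues j - η) * inner ℝ (b j) (WithLp.toLp 2 y) := by
    intro j
    have h1 : (b j).ofLp ⬝ᵥ (A *ᵥ y) = hH.eigenvalues j * ((b j).ofLp ⬝ᵥ y) := by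
      rw [Matrix.dotProduct_mulVec, ← Matrix.mulVec_transpose, hA.eq,
        hH.mulVec_eigenvectorBasis j, smul_dotProduct, smul_eq_mul]
    simp only [EuclideanSpace.inner_eq_star_dotProduct, star_trivial]
    rw [dotProduct_comm, dotProduct_sub, h1, dotProduct_smul, smul_eq_mul,
      dotProduct_comm y]
    ring
  have hn : ∀ z : ι → ℝ, ∑ j, inner ℝ (b j) (WithLp.toLp 2 z) ^ 2 = ∑ i, z i ^ 2 := by
    intro z
    have := b.sum_sq_norm_inner_right (WithLp.toLp 2 z)
    simpa [EuclideanSpace.norm_sq_eq] using this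
  have h2 := hn (A *ᵥ y - η • y)
  simp only [hcoord, Pi.sub_apply, Pi.smul_apply, smul_eq_mul] at h2
  rw [← h2, ← hn y, Finset.mul_sum] at h
  obtain ⟨j, hj⟩ : ∃ j, inner ℝ (b j) (WithLp.toLp 2 y) ≠ 0 := by
    by_contra! h0
    apply hy
    have h3 := hn y
    simp only [h0] at h3
    have h4 := (Finset.sum_eq_zero_iff_of_nonneg (fun i _ => sq_nonneg (y i))).1
      (by rw [← h3]; simp)
    funext i
    simpa using h4 i (Finset.mem_univ i)
  have hsq : ∀ j, ε ^ 2 < (hH.eigenvalues j - η) ^ 2 := fun j => by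
    rw [← sq_abs (hH.eigenvalues j - η)]
    exact pow_lt_pow_left₀ (hfar j) hε two_ne_zero
  refine absurd h (not_le.2 (Finset.sum_lt_sum (fun i _ => ?_) ⟨j, Finset.mem_univ j, ?_⟩))
  · rw [mul_pow]
    exact mul_le_mul_of_nonneg_right (hsq i).le (sq_nonneg _)
  · rw [mul_pow]
    exact mul_lt_mul_of_pos_right (hsq j) (by positivity)

theorem Matrix.mulVec_extend_zero {ι κ : Type*} [Fintype ι] [Fintype κ] (A : Matrix ι ι ℝ)
    {e : κ → ι} (he : Function.Injective e) (x : κ → ℝ) (i : ι) :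
    (A *ᵥ Function.extend e x 0) i = ∑ k, A i (e k) * x k := by
  symm
  refine Fintype.sum_of_injective e he _ _ (fun j hj => ?_) (fun k => ?_)
  · rw [Function.extend_apply' _ _ _ (by simpa using hj)]
    simp
  · rw [he.extend_apply]

theorem sum_sq_le_of_diagonal_gap {ι : Type*} [Fintype ι] {v : ι → ℝ} {B : Matrix ι ι ℝ} {M : ℝ}
    (hbd : ∀ z, ∑ i, (B *ᵥ z) i ^ 2 ≤ M ^ 2 * ∑ i, z i ^ 2) {s : Set ι} {η G : ℝ} (hG : 0 ≤ G)
    (hv : ∀ i ∉ s, G ≤ |v i - η|) {y z : ι → ℝ} (hz : ∀ i ∈ s, z i = 0)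
    (h : ∀ i ∉ s, (v i - η) * z i = -(B *ᵥ y) i) :
    G ^ 2 * ∑ i, z i ^ 2 ≤ M ^ 2 * ∑ i, y i ^ 2 := by
  refine le_trans ?_ (hbd y)
  rw [Finset.mul_sum]
  refine Finset.sum_le_sum fun i _ => ?_
  by_cases hi : i ∈ s
  · simp [hz i hi, sq_nonneg]
  · calc G ^ 2 * z i ^ 2 ≤ (v i - η) ^ 2 * z i ^ 2 := by
          refine mul_le_mul_of_nonneg_right ?_ (sq_nonneg _)
          rw [← sq_abs (v i - η)]
          exact pow_le_pow_left₀ hG (hv i hi) 2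
      _ = (B *ᵥ y) i ^ 2 := by rw [← mul_pow, h i hi, neg_sq]

/-- If outside the range of `e` the diagonal of `diagonal v + B` stays `G`-far from an
eigenvalue `η` of the compression to the range of `e`, and `‖B‖ ≤ M < G`, then `diagonal v + B`
has an eigenvalue within `M² / G` of `η`. -/
theorem exists_isEigenvalueOf_near_of_submatrix {ι κ : Type*} [Fintype ι] [DecidableEq ι]
    [Fintype κ] [DecidableEq κ] {v : ι → ℝ} {B : Matrix ι ι ℝ} (hB : B.IsSymm) {M : ℝ}
    (hM : 0 ≤ M) (hbd : ∀ z, ∑ i, (B *ᵥ z) i ^ 2 ≤ M ^ 2 * ∑ i, z i ^ 2) {e : κ → ι}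
    (he : Function.Injective e) {η G : ℝ} (hG : M < G)
    (hv : ∀ i ∉ Set.range e, G ≤ |v i - η|)
    (hη : ((diagonal v + B).submatrix e e).IsEigenvalueOf η) :
    ∃ η', (diagonal v + B).IsEigenvalueOf η' ∧ |η' - η| ≤ M ^ 2 / G := by
  classical
  have hG0 : 0 < G := hM.trans_lt hG
  obtain ⟨x, hx0, hx⟩ := hη
  set X : ι → ℝ := Function.extend e x 0 with hX
  have hXe : ∀ k, X (e k) = x k := fun k => he.extend_apply _ _ _
  have hX0 : ∀ i ∉ Set.range e, X i = 0 := fun i hi => by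
    rw [hX, Function.extend_apply' _ _ _ (by simpa using hi)]; rfl
  have hAX : ∀ i ∈ Set.range e, v i * X i + (B *ᵥ X) i = η * X i := by
    rintro _ ⟨k, rfl⟩
    have h1 := congrFun hx k
    have h2 := Matrix.mulVec_extend_zero (diagonal v + B) he x (e k)
    rw [← hX, add_mulVec, Pi.add_apply, mulVec_diagonal] at h2
    rw [h2, hXe]
    exact h1
  let f : {i // i ∉ Set.range e} → ι := Subtype.val
  have hf : Function.Injective f := Subtype.val_injective
  set N := (diagonal v + B - η • (1 : Matrix ι ι ℝ)).submatrix f f with hN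
  have hNmul : ∀ (u : {i // i ∉ Set.range e} → ℝ) (k),
      (N *ᵥ u) k = (v (f k) - η) * u k + (B *ᵥ Function.extend f u 0) (f k) := by
    intro u k
    have h2 := Matrix.mulVec_extend_zero (diagonal v + B - η • (1 : Matrix ι ι ℝ)) hf u (f k)
    rw [sub_mulVec, add_mulVec, Pi.sub_apply, Pi.add_apply, mulVec_diagonal, smul_mulVec,
      one_mulVec, Pi.smul_apply, smul_eq_mul, hf.extend_apply] at h2
    have h3 : (N *ᵥ u) k = _ := h2.symm
    rw [h3]; ring
  have hU0 : ∀ u : {i // i ∉ Set.range e} → ℝ, ∀ i ∈ Set.range e,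
      Function.extend f u 0 i = 0 := fun u i hi => by
    rw [Function.extend_apply' _ _ _ (by rintro ⟨⟨j, hj⟩, rfl⟩; exact hj hi)]; rfl
  have hinj : Function.Injective N.mulVec := by
    rw [← Matrix.coe_mulVecLin, injective_iff_map_eq_zero]
    intro u hu
    have h1 := sum_sq_le_of_diagonal_gap hbd hG0.le hv (y := Function.extend f u 0) (hU0 u)
      (fun i hi => by
        have h2 := hNmul u ⟨i, hi⟩
        have h3 : (N *ᵥ u) ⟨i, hi⟩ = 0 := congrFun hu ⟨i, hi⟩
        have h4 : Function.extend f u 0 i = u ⟨i, hi⟩ := hf.extend_apply u 0 ⟨i, hi⟩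
        rw [h4]
        linarith)
    have h5 : ∑ i, Function.extend f u 0 i ^ 2 = 0 := by
      have h6 : 0 ≤ ∑ i, Function.extend f u 0 i ^ 2 :=
        Finset.sum_nonneg fun i _ => sq_nonneg _
      have hGM : 0 < G ^ 2 - M ^ 2 := by nlinarith
      refine le_antisymm (le_of_mul_le_mul_left ?_ hGM) h6
      linarith
    have h7 := (Finset.sum_eq_zero_iff_of_nonneg (fun i _ => sq_nonneg _)).1 h5
    funext k
    have h8 := h7 (f k) (Finset.mem_univ _)
    rw [hf.extend_apply] at h8
    simpa using h8
  obtain ⟨u, hu⟩ := Matrix.mulVec_surjective_iff_isUnit.2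
    (Matrix.mulVec_injective_iff_isUnit.1 hinj) (fun k => -(B *ᵥ X) (f k))
  set U : ι → ℝ := Function.extend f u 0 with hU
  have hUeq : ∀ i ∉ Set.range e, (v i - η) * U i = -(B *ᵥ (X + U)) i := by
    intro i hi
    have h2 := hNmul u ⟨i, hi⟩
    have h3 : (N *ᵥ u) ⟨i, hi⟩ = -(B *ᵥ X) i := congrFun hu ⟨i, hi⟩
    have h4 : U i = u ⟨i, hi⟩ := hf.extend_apply u 0 ⟨i, hi⟩
    rw [h4, mulVec_add, Pi.add_apply]
    linarith
  have hsmall := sum_sq_le_of_diagonal_gap hbd hG0.le hv (hU0 u) hUeq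
  have hA : (diagonal v + B).IsSymm := (isSymm_diagonal v).add hB
  refine Matrix.exists_isEigenvalueOf_of_approx hA (div_nonneg (sq_nonneg M) hG0.le)
    (y := X + U) (fun h0 => hx0 ?_) ?_
  · funext k
    have h1 := congrFun h0 (e k)
    simpa [hXe, hU0 u (e k) ⟨k, rfl⟩, hU] using h1
  · have hle : ∑ i, (((diagonal v + B) *ᵥ (X + U)) i - η * (X + U) i) ^ 2
        ≤ ∑ i, (B *ᵥ U) i ^ 2 := by
      refine Finset.sum_le_sum fun i _ => ?_
      rw [add_mulVec, Pi.add_apply, mulVec_diagonal, Pi.add_apply]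
      by_cases hi : i ∈ Set.range e
      · have h1 := hAX i hi
        have h2 : U i = 0 := hU0 u i hi
        rw [h2, mulVec_add, Pi.add_apply]
        apply le_of_eq
        congr 1
        linarith
      · have h1 := hUeq i hi
        rw [hX0 i hi]
        refine le_of_eq_of_le ?_ (sq_nonneg _)
        rw [sq_eq_zero_iff]
        linarith
    have h3 : ∑ i, U i ^ 2 ≤ M ^ 2 * ∑ i, (X + U) i ^ 2 / G ^ 2 := by
      rw [← Finset.sum_div, mul_div_assoc', le_div_iff₀ (by positivity), mul_comm]
      exact hsmall
    calc _ ≤ _ := hle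
      _ ≤ M ^ 2 * ∑ i, U i ^ 2 := hbd U
      _ ≤ M ^ 2 * (M ^ 2 * ∑ i, (X + U) i ^ 2 / G ^ 2) := by gcongr
      _ = _ := by rw [← Finset.sum_div]; field_simp

/-- An eigenvalue of a compression of `diagonal v + B` with `‖B‖ ≤ M` is within `M` of one of the
corresponding diagonal entries. -/
theorem exists_diagonal_near_of_submatrix {ι κ : Type*} [Fintype ι] [DecidableEq ι]
    [Fintype κ] [DecidableEq κ] {v : ι → ℝ} {B : Matrix ι ι ℝ} {M : ℝ}
    (hM : 0 ≤ M) (hbd : ∀ z, ∑ i, (B *ᵥ z) i ^ 2 ≤ M ^ 2 * ∑ i, z i ^ 2) {e : κ → ι}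
    (he : Function.Injective e) {η : ℝ}
    (hη : ((diagonal v + B).submatrix e e).IsEigenvalueOf η) :
    ∃ k, |v (e k) - η| ≤ M := by
  obtain ⟨x, hx0, hx⟩ := hη
  by_contra! hcon
  have hB : ∀ k, (B *ᵥ Function.extend e x 0) (e k) = -((v (e k) - η) * x k) := by
    intro k
    have h1 : _ = η * x k := congrFun hx k
    have h2 := Matrix.mulVec_extend_zero (diagonal v + B) he x (e k)
    rw [add_mulVec, Pi.add_apply, mulVec_diagonal, he.extend_apply] at h2
    have h3 : ((diagonal v + B).submatrix e e *ᵥ x) k = _ := h2.symm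
    linarith
  have hsum : ∑ k, x k ^ 2 = ∑ i, Function.extend e x 0 i ^ 2 := by
    refine Fintype.sum_of_injective e he _ _ (fun j hj => ?_) (fun k => ?_)
    · rw [Function.extend_apply' _ _ _ (by simpa using hj)]
      simp
    · rw [he.extend_apply]
  have hle : ∑ k, (B *ᵥ Function.extend e x 0) (e k) ^ 2 ≤ M ^ 2 * ∑ k, x k ^ 2 := by
    rw [hsum]
    refine le_trans ?_ (hbd _)
    have := Finset.sum_le_univ_sum_of_nonneg (s := Finset.univ.map ⟨e, he⟩)
      (f := fun i => (B *ᵥ Function.extend e x 0) i ^ 2) (fun i => sq_nonneg _)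
    simpa [Finset.sum_map] using this
  obtain ⟨k, hk⟩ := Function.ne_iff.1 hx0
  refine absurd hle (not_le.2 ?_)
  rw [Finset.mul_sum]
  have hsq : ∀ k, M ^ 2 < (v (e k) - η) ^ 2 := fun k => by
    rw [← sq_abs (v (e k) - η)]
    exact pow_lt_pow_left₀ (hcon k) hM two_ne_zero
  refine Finset.sum_lt_sum (fun i _ => ?_) ⟨k, Finset.mem_univ k, ?_⟩
  · rw [hB, neg_sq, mul_pow]
    exact mul_le_mul_of_nonneg_right (hsq i).le (sq_nonneg _)
  · rw [hB, neg_sq, mul_pow]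
    have hk' : x k ≠ 0 := hk
    exact mul_lt_mul_of_pos_right (hsq k) (by positivity)

/-- Schur test for block matrices: if the row and column sums of the operator norms of the blocks
are at most `M`, the matrix has operator norm at most `M`. -/
theorem sum_sq_mulVec_le_of_block_norms {ι μ : Type*} [Fintype ι] [Fintype μ] [DecidableEq μ]
    (W : ι → ι → Matrix μ μ ℝ) (k : ι → ι → ℝ) {M : ℝ} (hM : 0 ≤ M)
    (hk : ∀ τ ξ, ‖Matrix.toEuclideanCLM (𝕜 := ℝ) (W τ ξ)‖ ≤ k τ ξ)
    (hrow : ∀ τ, ∑ ξ, k τ ξ ≤ M) (hcol : ∀ ξ, ∑ τ, k τ ξ ≤ M) (z : ι × μ → ℝ) :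
    ∑ p : ι × μ, (Matrix.mulVec (fun p q : ι × μ => W p.1 q.1 p.2 q.2) z p) ^ 2
      ≤ M ^ 2 * ∑ p, z p ^ 2 := by
  let Z : ι → EuclideanSpace ℝ μ := fun τ => WithLp.toLp 2 fun j => z (τ, j)
  have hk0 : ∀ τ ξ, 0 ≤ k τ ξ := fun τ ξ => (norm_nonneg _).trans (hk τ ξ)
  have hL : ∀ τ, ∑ j, (Matrix.mulVec (fun p q : ι × μ => W p.1 q.1 p.2 q.2) z (τ, j)) ^ 2
      = ‖∑ ξ, Matrix.toEuclideanCLM (𝕜 := ℝ) (W τ ξ) (Z ξ)‖ ^ 2 := by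
    intro τ
    rw [EuclideanSpace.norm_sq_eq]
    refine Finset.sum_congr rfl fun j _ => ?_
    rw [Real.norm_eq_abs, sq_abs]
    congr 1
    rw [WithLp.ofLp_sum, Finset.sum_apply]
    simp only [Matrix.mulVec, dotProduct, Fintype.sum_prod_type,
      Matrix.ofLp_toEuclideanCLM]
    rfl
  have hZ : ∀ ξ, ∑ j, z (ξ, j) ^ 2 = ‖Z ξ‖ ^ 2 := by
    intro ξ
    simp [EuclideanSpace.norm_sq_eq, Z]
  rw [Fintype.sum_prod_type, Fintype.sum_prod_type]
  simp only [hL, hZ]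
  calc ∑ τ, ‖∑ ξ, Matrix.toEuclideanCLM (𝕜 := ℝ) (W τ ξ) (Z ξ)‖ ^ 2
      ≤ ∑ τ, M * ∑ ξ, k τ ξ * ‖Z ξ‖ ^ 2 := by
        refine Finset.sum_le_sum fun τ _ => ?_
        have h1 : ‖∑ ξ, Matrix.toEuclideanCLM (𝕜 := ℝ) (W τ ξ) (Z ξ)‖
            ≤ ∑ ξ, k τ ξ * ‖Z ξ‖ :=
          (norm_sum_le _ _).trans (Finset.sum_le_sum fun ξ _ =>
            (ContinuousLinearMap.le_opNorm _ _).trans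
              (mul_le_mul_of_nonneg_right (hk τ ξ) (norm_nonneg _)))
        have h2 : (∑ ξ, k τ ξ * ‖Z ξ‖) ^ 2 ≤ (∑ ξ, k τ ξ) * ∑ ξ, k τ ξ * ‖Z ξ‖ ^ 2 :=
          Finset.sum_sq_le_sum_mul_sum_of_sq_le_mul _ (fun ξ _ => hk0 τ ξ)
            (fun ξ _ => mul_nonneg (hk0 τ ξ) (sq_nonneg _)) (fun ξ _ => le_of_eq (by ring))
        exact (pow_le_pow_left₀ (norm_nonneg _) h1 2).trans (h2.trans
          (mul_le_mul_of_nonneg_right (hrow τ)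
            (Finset.sum_nonneg fun ξ _ => mul_nonneg (hk0 τ ξ) (sq_nonneg _))))
    _ = M * ∑ ξ, (∑ τ, k τ ξ) * ‖Z ξ‖ ^ 2 := by
        rw [← Finset.mul_sum, Finset.sum_comm]
        simp only [Finset.sum_mul]
    _ ≤ M * ∑ ξ, M * ‖Z ξ‖ ^ 2 := by
        gcongr with ξ
        exact hcol ξ
    _ = M ^ 2 * ∑ ξ, ‖Z ξ‖ ^ 2 := by rw [← Finset.mul_sum]; ring

theorem halfLattice_sub_mem {d : ℕ} {a : Fin d → ℝ} {x y : EuclideanSpace ℝ (Fin d)}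
    (hx : x ∈ halfLattice a) (hy : y ∈ halfLattice a) : x - y ∈ halfLattice a := by
  obtain ⟨n, hn⟩ := hx
  obtain ⟨k, hk⟩ := hy
  refine ⟨n - k, fun i => ?_⟩
  simp only [PiLp.sub_apply, hn, hk, Pi.sub_apply, Int.cast_sub]
  ring

theorem halfLattice_add_mem {d : ℕ} {a : Fin d → ℝ} {x y : EuclideanSpace ℝ (Fin d)}
    (hx : x ∈ halfLattice a) (hy : y ∈ halfLattice a) : x + y ∈ halfLattice a := by
  obtain ⟨n, hn⟩ := hx
  obtain ⟨k, hk⟩ := hy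
  refine ⟨n + k, fun i => ?_⟩
  simp only [PiLp.add_apply, hn, hk, Pi.add_apply, Int.cast_add]
  ring

theorem halfLattice_zsmul_mem {d : ℕ} {a : Fin d → ℝ} {x : EuclideanSpace ℝ (Fin d)}
    (hx : x ∈ halfLattice a) (k : ℤ) : (k : ℝ) • x ∈ halfLattice a := by
  obtain ⟨n, hn⟩ := hx
  refine ⟨k • n, fun i => ?_⟩
  simp only [PiLp.smul_apply, hn, Pi.smul_apply, smul_eq_mul, Int.cast_mul]
  ring

theorem halfLattice_exists_norm_lower_bound {d : ℕ} {a : Fin d → ℝ} (ha : ∀ i, 0 < a i) :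
    ∃ κ > 0, ∀ x ∈ halfLattice a, x ≠ 0 → κ ≤ ‖x‖ := by
  have hsum : 0 ≤ ∑ i, a i := Finset.sum_nonneg fun i _ => (ha i).le
  refine ⟨Real.pi / (2 * (1 + ∑ i, a i)), by positivity, ?_⟩
  rintro x ⟨n, hn⟩ hx
  obtain ⟨i, hi⟩ : ∃ i, x i ≠ 0 := by
    by_contra! h
    exact hx (by ext i; exact h i)
  have hai := ha i
  have hni : (1 : ℝ) ≤ |(n i : ℝ)| := by
    have : n i ≠ 0 := fun h0 => hi (by rw [hn, h0]; simp)
    exact_mod_cast Int.one_le_abs this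
  have hle : a i ≤ 1 + ∑ i, a i := by
    have := Finset.single_le_sum (f := a) (fun j _ => (ha j).le) (Finset.mem_univ i)
    linarith
  calc Real.pi / (2 * (1 + ∑ i, a i)) ≤ 1 * Real.pi / (2 * a i) := by
        rw [one_mul]; gcongr
    _ ≤ |(n i : ℝ)| * Real.pi / (2 * a i) := by gcongr
    _ = ‖x i‖ := by
        rw [hn, Real.norm_eq_abs, abs_div, abs_mul, abs_of_pos Real.pi_pos,
          abs_of_pos (by positivity : 0 < 2 * a i)]
    _ ≤ ‖x‖ := PiLp.norm_apply_le x i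

/-- Along a resonant direction, integer shifts of `γ` raise `‖·‖²` by a controlled, essentially
nonnegative amount. -/
theorem norm_sq_add_zsmul_bounds {E : Type*} [NormedAddCommGroup E] [InnerProductSpace ℝ E]
    {γ δ : E} {κ T N t : ℝ} (hκ : 0 < κ) (hδ : κ ≤ ‖δ‖) (hγ : |‖γ‖ ^ 2 - ‖γ + δ‖ ^ 2| ≤ T)
    (n : ℤ) (hn : ‖(n : ℝ) • δ‖ ≤ t) (hN : t ≤ κ * N) :
    -(N * T) ≤ ‖γ + (n : ℝ) • δ‖ ^ 2 - ‖γ‖ ^ 2 ∧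
      ‖γ + (n : ℝ) • δ‖ ^ 2 - ‖γ‖ ^ 2 ≤ N * T + 2 * t ^ 2 := by
  rw [norm_add_sq_real] at hγ
  rw [norm_add_sq_real, real_inner_smul_right]
  rw [norm_smul, Real.norm_eq_abs] at hn
  rw [norm_smul, Real.norm_eq_abs, mul_pow, sq_abs]
  have hT : 0 ≤ T := (abs_nonneg _).trans hγ
  have hnN : |(n : ℝ)| ≤ N := by
    have : κ * |(n : ℝ)| ≤ κ * N := by
      nlinarith [abs_nonneg (n : ℝ)]
    exact le_of_mul_le_mul_left this hκ
  have h1 : |(n : ℝ) * (2 * inner ℝ γ δ + ‖δ‖ ^ 2)| ≤ N * T := by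
    rw [abs_mul]
    refine mul_le_mul hnN ?_ (abs_nonneg _) ((abs_nonneg _).trans hnN)
    have h0 : 2 * inner ℝ γ δ + ‖δ‖ ^ 2
        = -(‖γ‖ ^ 2 - (‖γ‖ ^ 2 + 2 * inner ℝ γ δ + ‖δ‖ ^ 2)) := by ring
    rw [h0, abs_neg]
    exact hγ
  have h2 : (0 : ℝ) ≤ (n : ℝ) ^ 2 - n := by
    have h : (0 : ℤ) ≤ n ^ 2 - n := by
      rcases le_or_gt n 0 with h | h <;> nlinarith
    exact_mod_cast h
  have h3 : (0 : ℝ) ≤ (n : ℝ) ^ 2 + n := by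
    have h : (0 : ℤ) ≤ n ^ 2 + n := by
      rcases le_or_gt 0 n with h | h <;> nlinarith
    exact_mod_cast h
  have h4 : (n : ℝ) ^ 2 * ‖δ‖ ^ 2 ≤ t ^ 2 := by
    have := pow_le_pow_left₀ (by positivity) hn 2
    rwa [mul_pow, sq_abs] at this
  have h5 := mul_nonneg h2 (sq_nonneg ‖δ‖)
  have h6 := mul_nonneg h3 (sq_nonneg ‖δ‖)
  obtain ⟨h7, h8⟩ := abs_le.1 h1
  constructor <;> nlinarith

/-- The gap between `‖·‖²` on a resonant line through `γ` and off that line. -/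
theorem norm_sq_gap {E : Type*} [NormedAddCommGroup E] [InnerProductSpace ℝ E]
    {γ δ w : E} {κ T N s q : ℝ} (hκ : 0 < κ) (hδ : κ ≤ ‖δ‖)
    (hγ : |‖γ‖ ^ 2 - ‖γ + δ‖ ^ 2| ≤ T) (hs : 0 ≤ s) (hq : 0 ≤ q)
    (hw : ‖w‖ ≤ q) (hγw : s ^ 2 ≤ |‖γ‖ ^ 2 - ‖γ + w‖ ^ 2|)
    (n k : ℤ) (hn : ‖(n : ℝ) • δ‖ ≤ s / 2 + q) (hk : ‖(k : ℝ) • δ‖ ≤ s / 2)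
    (hN : s / 2 + q ≤ κ * N) (hsmall : 3 * s * q + 2 * q ^ 2 + 2 * (N * T) ≤ s ^ 2 / 4) :
    s ^ 2 / 4 ≤ |‖γ + (k : ℝ) • δ + w‖ ^ 2 - ‖γ + (n : ℝ) • δ‖ ^ 2| := by
  obtain ⟨h1, h2⟩ := norm_sq_add_zsmul_bounds hκ hδ hγ n hn hN
  obtain ⟨h3, h4⟩ := norm_sq_add_zsmul_bounds (N := N) hκ hδ hγ k hk (by linarith)
  have h5 : |inner ℝ ((k : ℝ) • δ) w| ≤ s / 2 * q :=
    (abs_real_inner_le_norm _ _).trans (mul_le_mul hk hw (norm_nonneg _) (by linarith))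
  obtain ⟨h6, h7⟩ := abs_le.1 h5
  have h8 : ‖γ + (k : ℝ) • δ + w‖ ^ 2 = ‖γ + (k : ℝ) • δ‖ ^ 2 + (‖γ + w‖ ^ 2 - ‖γ‖ ^ 2)
      + 2 * inner ℝ ((k : ℝ) • δ) w := by
    rw [norm_add_sq_real (γ + (k : ℝ) • δ) w, norm_add_sq_real γ w, inner_add_left]
    ring
  have hsq : 0 ≤ s * q := mul_nonneg hs hq
  have h9 : 2 * (s / 2 + q) ^ 2 = s ^ 2 / 2 + 2 * (s * q) + 2 * q ^ 2 := by ring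
  have h10 : 2 * (s / 2) ^ 2 = s ^ 2 / 2 := by ring
  have hq2 : 0 ≤ q ^ 2 := sq_nonneg q
  rw [h9] at h2
  rw [h10] at h4
  rw [h8]
  rcases le_abs.1 hγw with h | h
  · refine le_trans ?_ (neg_le_abs _)
    linarith
  · refine le_trans ?_ (le_abs_self _)
    linarith

/-- Points of `B₁(γ,p₁)` on and off the line `γ + ℤδ` have well separated `‖·‖²`. -/
theorem B1Set_norm_sq_gap {d : ℕ} {a : Fin d → ℝ} {δ γ x y : EuclideanSpace ℝ (Fin d)}
    {ρ α κ : ℝ} {p₁ : ℕ} (hρ : 0 ≤ ρ) (hκ : 0 < κ) (hδ : κ ≤ ‖δ‖)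
    (hmin : ∀ x ∈ halfLattice a, (∃ t : ℝ, x = t • δ) → ∃ n : ℤ, x = (n : ℝ) • δ)
    (hγ : γ ∈ resDomain δ (ρ ^ (3 * α)))
    (hγw : ∀ w ∈ latticeBall a ((p₁ : ℝ) * ρ ^ α), (¬∃ t : ℝ, w = t • δ) →
      γ ∉ resDomain w (ρ ^ (9 * α)))
    (hx : x ∈ B1Set a δ γ ρ α p₁) (hxn : ∃ n : ℤ, x = γ + (n : ℝ) • δ)
    (hy : y ∈ B1Set a δ γ ρ α p₁) (hyn : ¬∃ n : ℤ, y = γ + (n : ℝ) • δ)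
    (hρ1 : 1 ≤ ρ ^ α)
    (hρ2 : 4 * (3 * p₁ + 2 * (p₁ : ℝ) ^ 2 + 2 * ((1 + p₁) / κ)) ≤ ρ ^ α) :
    ρ ^ (9 * α) / 4 ≤ |‖y‖ ^ 2 - ‖x‖ ^ 2| := by
  set r := ρ ^ α with hr
  set s := ρ ^ (9 * α / 2) with hs
  set p : ℝ := (p₁ : ℝ) with hp
  have hp0 : 0 ≤ p := Nat.cast_nonneg _
  have hr3 : ρ ^ (3 * α) = r ^ 3 := by
    rw [hr, ← Real.rpow_natCast, ← Real.rpow_mul hρ]; congr 1; push_cast; ring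
  have hr9 : ρ ^ (9 * α) = r ^ 9 := by
    rw [hr, ← Real.rpow_natCast, ← Real.rpow_mul hρ]; congr 1; push_cast; ring
  have hs9 : ρ ^ (9 * α) = s ^ 2 := by
    rw [hs, ← Real.rpow_natCast, ← Real.rpow_mul hρ]; congr 1; push_cast; ring
  have hs0 : 0 ≤ s := Real.rpow_nonneg hρ _
  have hrs : r ^ 4 ≤ s := by
    refine le_of_sq_le_sq ?_ hs0
    rw [← hs9, hr9, ← pow_mul]
    exact pow_le_pow_right₀ hρ1 (by norm_num)
  have hball : ∀ w ∈ latticeBall a (p * r) ∪ {0}, ‖w‖ ≤ p * r := by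
    rintro w (hw | hw)
    · exact hw.2.2.le
    · rw [Set.mem_singleton_iff.1 hw, norm_zero]
      positivity
  obtain ⟨n, rfl⟩ := hxn
  obtain ⟨n₀, hn₀, w₀, hw₀, hxw⟩ := hx
  obtain ⟨k, hk, w, hw, rfl⟩ := hy
  have hn : ‖(n : ℝ) • δ‖ ≤ s / 2 + p * r := by
    have : (n : ℝ) • δ = (n₀ : ℝ) • δ + w₀ := by
      rw [add_assoc] at hxw
      exact add_left_cancel hxw
    rw [this]
    exact (norm_add_le _ _).trans (add_le_add (by linarith) (hball w₀ hw₀))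
  have hwδ : ¬∃ t : ℝ, w = t • δ := by
    intro ht
    apply hyn
    rcases hw with hw' | hw'
    · obtain ⟨l, rfl⟩ := hmin w hw'.1 ht
      exact ⟨k + l, by push_cast; rw [add_smul, add_assoc]⟩
    · rw [Set.mem_singleton_iff.1 hw']
      exact ⟨k, add_zero _⟩
  have hw' : w ∈ latticeBall a (p * r) := by
    rcases hw with hw' | hw'
    · exact hw'
    · exact absurd ⟨0, by rw [Set.mem_singleton_iff.1 hw', zero_smul]⟩ hwδ
  have hres := hγw w hw' hwδ
  simp only [resDomain, Set.mem_ofPred_eq, not_lt] at hres hγ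
  rw [hs9] at hres ⊢
  rw [hr3] at hγ
  have hr4 : r ≤ r ^ 4 := le_self_pow₀ hρ1 (by norm_num)
  have hr0 : 0 < r := by linarith
  have hprs : p * r ≤ p * s := mul_le_mul_of_nonneg_left (hr4.trans hrs) hp0
  refine norm_sq_gap (N := (1 + p) * s / κ) hκ hδ hγ.le hs0 (by positivity)
    (hball w hw) hres n k hn (by linarith) ?_ ?_
  · rw [mul_div_cancel₀ _ hκ.ne']
    linarith
  · have h3 : r ^ 3 * r ≤ s := by rw [← pow_succ]; exact hrs
    have h2 : r * r ≤ s := by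
      refine le_trans ?_ hrs
      rw [← sq]; exact pow_le_pow_right₀ hρ1 (by norm_num)
    have hrs1 : r ≤ s := hr4.trans hrs
    set Q := (1 + p) / κ with hQ
    have hQ0 : 0 ≤ Q := by positivity
    have e1 : (1 + p) * s / κ = Q * s := by rw [hQ]; ring
    rw [e1]
    have t1 : p * s * (r * r) ≤ p * s * s := by gcongr
    have t2 : p ^ 2 * (r * (r * r)) ≤ p ^ 2 * (s * s) := by gcongr
    have t3 : Q * s * (r ^ 3 * r) ≤ Q * s * s := by gcongr
    have t4 : (4 * (3 * p + 2 * p ^ 2 + 2 * Q)) * s ^ 2 ≤ r * s ^ 2 := by gcongr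
    refine le_of_mul_le_mul_right ?_ hr0
    nlinarith

/-- STATEMENT 5 (Theorem 2.3 of the paper), with `α₁ = 3α`, `α₂ = 9α`: every eigenvalue of the
leading principal submatrix `D(γ,δ)` is `O(ρ^{−(1/2)α₂})`-close to an eigenvalue of `C(γ,δ)`. -/
theorem stmt5 (d : ℕ) (hd : 2 ≤ d) (m : ℕ) (hm : 2 ≤ m)
    (a : Fin d → ℝ) (ha : ∀ i, 0 < a i)
    (α : ℝ) (hα0 : 0 < α) (hα1 : α < 1 / ((d : ℝ) + 20))
    (p₁ : ℕ) (hp₁ : 0 < p₁) (M : ℝ) (hM : 0 < M)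
    (c₁ c₂ : ℝ) (hc₁ : 0 < c₁) (hc₂ : 0 < c₂) :
    ∃ c > (0 : ℝ), ∃ ρ₀ > (0 : ℝ), ∀ ρ : ℝ, ρ₀ ≤ ρ →
      ∀ V : EuclideanSpace ℝ (Fin d) → Matrix (Fin m) (Fin m) ℝ,
        (∀ b ∈ halfLattice a, (V b).IsSymm) →
        (∀ b ∈ halfLattice a, V (-b) = (V b)ᵀ) →
        Summable (fun b : halfLattice a => ‖Matrix.toEuclideanCLM (𝕜 := ℝ) (V b)‖) →
        (∑' b : halfLattice a, ‖Matrix.toEuclideanCLM (𝕜 := ℝ) (V b)‖) ≤ M →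
      ∀ δ : EuclideanSpace ℝ (Fin d), δ ∈ halfLattice a → δ ≠ 0 →
        (∀ x ∈ halfLattice a, (∃ t : ℝ, x = t • δ) → ∃ n : ℤ, x = (n : ℝ) • δ) →
      ∀ γ : EuclideanSpace ℝ (Fin d),
        c₁ * ρ ≤ ‖γ‖ → ‖γ‖ ≤ c₂ * ρ →
        γ ∈ resDomain δ (ρ ^ (3 * α)) →
        (∀ w ∈ latticeBall a ((p₁ : ℝ) * ρ ^ α), (¬∃ t : ℝ, w = t • δ) →
          γ ∉ resDomain w (ρ ^ (9 * α))) →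
      ∀ b₁ a₁ : ℕ, ∀ hab : a₁ ≤ b₁,
      ∀ h : Fin b₁ → EuclideanSpace ℝ (Fin d), Function.Injective h →
        Set.range h = B1Set a δ γ ρ α p₁ →
        (∀ τ : Fin b₁, ((τ : ℕ) < a₁ ↔ ∃ n : ℤ, h τ = γ + (n : ℝ) • δ)) →
      ∀ η' : ℝ, (blockC V (fun i : Fin a₁ => h (Fin.castLE hab i))).IsEigenvalueOf η' →
        ∃ η : ℝ, (blockC V h).IsEigenvalueOf η ∧
          |η - η'| ≤ c * ρ ^ (-(1 / 2) * (9 * α)) := by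
  obtain ⟨κ, hκ, hκδ⟩ := halfLattice_exists_norm_lower_bound ha
  set R : ℝ := 1 + 4 * (3 * p₁ + 2 * (p₁ : ℝ) ^ 2 + 2 * ((1 + p₁) / κ)) + 16 * M with hR
  have hR1 : 4 * (3 * p₁ + 2 * (p₁ : ℝ) ^ 2 + 2 * ((1 + p₁) / κ)) ≤ R := by linarith
  have hR2 : 1 + 16 * M ≤ R := by
    have : 0 ≤ 4 * (3 * p₁ + 2 * (p₁ : ℝ) ^ 2 + 2 * ((1 + p₁) / κ)) := by positivity
    linarith
  have hR0 : 1 ≤ R := by linarith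
  refine ⟨8 * M ^ 2, by positivity, R ^ (1 / α), by positivity, ?_⟩
  intro ρ hρ V _ hVt hsum htsum δ hδ hδ0 hmin γ _ _ hγ hγw b₁ a₁ hab h hinj hrange hidx η' hη'
  have hρ1 : 1 ≤ ρ := (Real.one_le_rpow hR0 (by positivity)).trans hρ
  have hρ0 : 0 ≤ ρ := by linarith
  have hRρ : R ≤ ρ ^ α := by
    have := Real.rpow_le_rpow (by positivity) hρ hα0.le
    rwa [← Real.rpow_mul (by positivity), one_div_mul_cancel hα0.ne', Real.rpow_one] at this
  have hr9 : ρ ^ α ≤ ρ ^ (9 * α) := Real.rpow_le_rpow_of_exponent_le hρ1 (by linarith)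
  have hmem : ∀ τ, h τ ∈ B1Set a δ γ ρ α p₁ := fun τ => hrange ▸ Set.mem_range_self τ
  have hdiff : ∀ τ ξ, h τ - h ξ ∈ halfLattice a := by
    have hz : (0 : EuclideanSpace ℝ (Fin d)) ∈ halfLattice a := by
      simpa using halfLattice_zsmul_mem hδ 0
    have hd : ∀ τ, h τ - γ ∈ halfLattice a := by
      intro τ
      obtain ⟨n, _, w, hw, hx⟩ := hmem τ
      have hw' : w ∈ halfLattice a := by
        rcases hw with hw | hw
        · exact hw.1
        · rwa [Set.mem_singleton_iff.1 hw]
      rw [hx, add_assoc, add_sub_cancel_left]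
      exact halfLattice_add_mem (halfLattice_zsmul_mem hδ n) hw'
    intro τ ξ
    simpa using halfLattice_sub_mem (hd τ) (hd ξ)
  let W : Fin b₁ → Fin b₁ → Matrix (Fin m) (Fin m) ℝ := fun τ ξ =>
    if τ = ξ then 0 else V (h τ - h ξ)
  let B : Matrix (Fin b₁ × Fin m) (Fin b₁ × Fin m) ℝ := fun p q => W p.1 q.1 p.2 q.2
  let v : Fin b₁ × Fin m → ℝ := fun p => ‖h p.1‖ ^ 2
  have hWsymm : ∀ τ ξ i j, W τ ξ i j = W ξ τ j i := by
    intro τ ξ i j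
    by_cases hτ : τ = ξ
    · simp [W, hτ]
    · have h1 : V (h ξ - h τ) = (V (h τ - h ξ))ᵀ := by
        rw [← hVt _ (hdiff τ ξ), neg_sub]
      simp [W, hτ, Ne.symm hτ, h1]
  have hBsymm : B.IsSymm := by
    ext p q
    exact hWsymm q.1 p.1 q.2 p.2
  have hC : blockC V h = diagonal v + B := by
    ext p q
    obtain ⟨τ, i⟩ := p
    obtain ⟨ξ, j⟩ := q
    rw [Matrix.add_apply]
    by_cases hτ : τ = ξ
    · by_cases hi : i = j <;> simp [blockC, B, W, v, hτ, hi]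
    · simp [blockC, B, W, v, hτ]
  have hnorm : ∀ τ ξ, ‖Matrix.toEuclideanCLM (𝕜 := ℝ) (W τ ξ)‖
      ≤ ‖Matrix.toEuclideanCLM (𝕜 := ℝ) (V (h τ - h ξ))‖ := by
    intro τ ξ
    by_cases hτ : τ = ξ
    · simp [W, hτ]
    · simp [W, hτ]
  have hfin : ∀ g : Fin b₁ → halfLattice a, Function.Injective g →
      ∑ ξ, ‖Matrix.toEuclideanCLM (𝕜 := ℝ) (V (g ξ))‖ ≤ M := by
    intro g hg
    have := hsum.sum_le_tsum (Finset.univ.map ⟨g, hg⟩) (fun _ _ => norm_nonneg _)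
    rw [Finset.sum_map] at this
    exact this.trans htsum
  have hbd : ∀ z, ∑ p, (B *ᵥ z) p ^ 2 ≤ M ^ 2 * ∑ p, z p ^ 2 := by
    refine sum_sq_mulVec_le_of_block_norms W
      (fun τ ξ => ‖Matrix.toEuclideanCLM (𝕜 := ℝ) (V (h τ - h ξ))‖) hM.le hnorm
      (fun τ => ?_) (fun ξ => ?_)
    · exact hfin (fun ξ => ⟨h τ - h ξ, hdiff τ ξ⟩)
        (fun x y hxy => hinj (sub_right_injective (Subtype.ext_iff.1 hxy)))
    · exact hfin (fun τ => ⟨h τ - h ξ, hdiff τ ξ⟩)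
        (fun x y hxy => hinj (sub_left_injective (Subtype.ext_iff.1 hxy)))
  let e : Fin a₁ × Fin m → Fin b₁ × Fin m := Prod.map (Fin.castLE hab) id
  have he : Function.Injective e := (Fin.castLE_injective hab).prodMap Function.injective_id
  have hD : blockC V (fun i : Fin a₁ => h (Fin.castLE hab i))
      = (diagonal v + B).submatrix e e := by
    rw [← hC]
    ext p q
    simp [blockC, e]
  rw [hD] at hη'
  obtain ⟨k, hk⟩ := exists_diagonal_near_of_submatrix hM.le hbd he hη'
  have hgap : ∀ p ∉ Set.range e, ρ ^ (9 * α) / 8 ≤ |v p - η'| := by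
    rintro ⟨τ, j⟩ hp
    have hτ : ¬ (τ : ℕ) < a₁ := fun hlt => hp ⟨(⟨τ, hlt⟩, j), rfl⟩
    have h1 := B1Set_norm_sq_gap hρ0 hκ (hκδ δ hδ hδ0) hmin hγ hγw
      (hmem (Fin.castLE hab k.1)) ((hidx _).1 k.1.2) (hmem τ) (fun hn => hτ ((hidx τ).2 hn))
      (hR0.trans hRρ) (hR1.trans hRρ)
    have h2 := abs_sub_le (v (τ, j)) η' (v (e k))
    rw [abs_sub_comm η'] at h2
    have h3 : |‖h τ‖ ^ 2 - ‖h (Fin.castLE hab k.1)‖ ^ 2| = |v (τ, j) - v (e k)| := rfl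
    linarith
  obtain ⟨η, hη, hle⟩ := exists_isEigenvalueOf_near_of_submatrix hBsymm hM.le hbd he
    (by linarith) hgap hη'
  refine ⟨η, hC ▸ hη, hle.trans ?_⟩
  calc M ^ 2 / (ρ ^ (9 * α) / 8) = 8 * M ^ 2 * ρ ^ (-(9 * α)) := by
        rw [Real.rpow_neg hρ0]
        field_simp
    _ ≤ 8 * M ^ 2 * ρ ^ (-(1 / 2) * (9 * α)) := by
        refine mul_le_mul_of_nonneg_left ?_ (by positivity)
        exact Real.rpow_le_rpow_of_exponent_le hρ1 (by linarith)
end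
end
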